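/- arXiv:1612.02381 — 2 statements merged into one kernel-verified Lean document; each statement's English description precedes it below -/
import Mathlib

section
/- For every partition λ = (λ_1, λ_2) of n with exactly two positive parts satisfying λ_2 ≥ 2 (equivalently λ ⊇ (2,2)), b(λ,2) = (n² − 3n)/2. -/
/-- `λ^{(i)}` (here `i` is 0-indexed): decrease the `i`-th part of `l` by one,
drop any zero parts, and re-sort in weakly decreasing order. -/
def decPart (l : List ℕ) (i : ℕ) : List ℕ :=
  List.insertionSort (· ≥ ·) ((l.set i (l.getD i 0 - 1)).filter (fun x => x ≠ 0))

/-- Auxiliary function computing `b(λ, k)` with explicit fuel (the fuel will be `|λ|`). -/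
def bAux : ℕ → List ℕ → ℤ → ℕ
  | 0, l, k => if l = [] ∧ k = 0 then 1 else 0
  | fuel + 1, l, k =>
      if k < 0 then 0
      else if l = [] then (if k = 0 then 1 else 0)
      else ∑ i ∈ Finset.range l.length, bAux fuel (decPart l i) (k - i)

/-- `b(λ, k)`, defined by recursion on `|λ|`: `b(λ,k) = 0` for `k < 0`,
`b(∅,k) = δ_{k,0}`, and `b(λ,k) = Σ_{i=1}^{ℓ(λ)} b(λ^{(i)}, k−i+1)` when `ℓ(λ) ≥ 1`.
By Fresse's recursion this is the `2k`-th Betti number of the Springer fiber of a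
nilpotent of Jordan type `λ` in `GL_{|λ|}(ℂ)`. A partition is represented by a
weakly decreasing list of positive naturals. -/
def springerBetti (l : List ℕ) (k : ℤ) : ℕ := bAux l.sum l k

/-- The `r`-tuple `A_{k,r}` (0-indexed list): `α_1 = α_2 = ⌊(k+r−2)/(r−1)⌋` and
`α_i = ⌊(k+r−i)/(r−1)⌋` for `3 ≤ i ≤ r`. -/
def Akr (k r : ℕ) : List ℕ :=
  List.ofFn (fun j : Fin r =>
    if j.val = 0 then (k + r - 2) / (r - 1) else (k + r - (j.val + 1)) / (r - 1))

theorem springerBetti_of_neg (l : List ℕ) (hl : l ≠ []) {k : ℤ} (hk : k < 0) :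
    springerBetti l k = 0 := by
  unfold springerBetti
  cases l.sum <;> simp [bAux, hk, hl]

theorem springerBetti_singleton (a : ℕ) (k : ℤ) :
    springerBetti [a] k = if k = 0 ∧ 0 < a then 1 else 0 := by
  have haux (a : ℕ) (k : ℤ) : bAux (a + 1) [a + 1] k = if k = 0 then 1 else 0 := by
    induction a with
    | zero =>
      rw [bAux]
      by_cases hk : k < 0
      · simp [hk, hk.ne]
      · simp [hk, decPart, bAux, -Finset.sum_boole]
    | succ a ih =>
      rw [bAux]
      by_cases hk : k < 0
      · simp [hk, hk.ne]
      · simpa [hk, decPart] using ih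
  cases a with
  | zero => simp [springerBetti, bAux]
  | succ a => simpa [springerBetti] using haux a k

theorem springerBetti_pair {a b : ℕ} (hb : 0 < b) {k : ℤ} (hk : 0 ≤ k) :
    springerBetti [a, b] k =
      bAux (a + b - 1) (decPart [a, b] 0) k + bAux (a + b - 1) (decPart [a, b] 1) (k - 1) := by
  obtain ⟨m, hm⟩ : ∃ m, a + b = m + 1 := ⟨a + b - 1, by omega⟩
  simp [springerBetti, hm, bAux, hk.not_gt, Finset.sum_range_succ]

theorem springerBetti_succ_add_two {a b : ℕ} (hab : b + 2 ≤ a) {k : ℤ} (hk : 0 ≤ k) :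
    springerBetti [a + 1, b + 2] k =
      springerBetti [a, b + 2] k + springerBetti [a + 1, b + 1] (k - 1) := by
  rw [springerBetti_pair (by omega) hk]
  have h₀ : decPart [a + 1, b + 2] 0 = [a, b + 2] := by
    have : a ≠ 0 := by omega
    simp [decPart, this, hab]
  have h₁ : decPart [a + 1, b + 2] 1 = [a + 1, b + 1] := by
    have : b ≤ a := by omega
    simp [decPart, this]
  rw [h₀, h₁]
  simp [springerBetti, add_assoc, add_comm, add_left_comm]

theorem springerBetti_add_two_self (a : ℕ) {k : ℤ} (hk : 0 ≤ k) :
    springerBetti [a + 2, a + 2] k =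
      springerBetti [a + 2, a + 1] k + springerBetti [a + 2, a + 1] (k - 1) := by
  rw [springerBetti_pair (by omega) hk]
  have h₀ : decPart [a + 2, a + 2] 0 = [a + 2, a + 1] := by
    simp [decPart]
  have h₁ : decPart [a + 2, a + 2] 1 = [a + 2, a + 1] := by
    simp [decPart]
  rw [h₀, h₁]
  simp [springerBetti, ← add_assoc]

theorem springerBetti_succ_one {a : ℕ} (ha : 0 < a) {k : ℤ} (hk : 0 ≤ k) :
    springerBetti [a + 1, 1] k = springerBetti [a, 1] k + springerBetti [a + 1] (k - 1) := by
  rw [springerBetti_pair (by omega) hk]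
  have h₀ : decPart [a + 1, 1] 0 = [a, 1] := by
    have : 1 ≤ a := ha
    simp [decPart, ha.ne', this]
  have h₁ : decPart [a + 1, 1] 1 = [a + 1] := by
    simp [decPart]
  rw [h₀, h₁]
  simp [springerBetti]

theorem springerBetti_one_one {k : ℤ} (hk : 0 ≤ k) :
    springerBetti [1, 1] k = springerBetti [1] k + springerBetti [1] (k - 1) := by
  rw [springerBetti_pair one_pos hk]
  simp [decPart, springerBetti]

theorem springerBetti_hook_zero (a : ℕ) : springerBetti [a + 1, 1] 0 = 1 := by
  induction a with
  | zero => simp [springerBetti_one_one, springerBetti_singleton]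
  | succ a ih => simp [springerBetti_succ_one, springerBetti_singleton, ih]

theorem springerBetti_hook_one (a : ℕ) : springerBetti [a + 1, 1] 1 = a + 1 := by
  induction a with
  | zero => simp [springerBetti_one_one, springerBetti_singleton]
  | succ a ih => simp [springerBetti_succ_one, springerBetti_singleton, ih]

theorem springerBetti_hook_two (a : ℕ) : springerBetti [a + 1, 1] 2 = 0 := by
  induction a with
  | zero => simp [springerBetti_one_one, springerBetti_singleton]
  | succ a ih => simp [springerBetti_succ_one, springerBetti_singleton, ih]

theorem springerBetti_pair_zero {a b : ℕ} (hab : b + 1 ≤ a) : springerBetti [a, b + 1] 0 = 1 := by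
  induction b generalizing a with
  | zero =>
    obtain ⟨c, rfl⟩ := Nat.exists_eq_add_of_le' hab
    exact springerBetti_hook_zero c
  | succ b ih =>
    induction a, hab using Nat.le_induction with
    | base =>
      rw [springerBetti_add_two_self b le_rfl, ih (by omega),
        springerBetti_of_neg _ (by simp) (by norm_num)]
    | succ a hab iha =>
      rw [springerBetti_succ_add_two hab le_rfl, iha,
        springerBetti_of_neg _ (by simp) (by norm_num)]

theorem springerBetti_pair_one {a b : ℕ} (hab : b + 1 ≤ a) :
    springerBetti [a, b + 1] 1 = a + b := by
  induction b generalizing a with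
  | zero =>
    obtain ⟨c, rfl⟩ := Nat.exists_eq_add_of_le' hab
    exact springerBetti_hook_one c
  | succ b ih =>
    induction a, hab using Nat.le_induction with
    | base =>
      rw [springerBetti_add_two_self b zero_le_one, ih (by omega), sub_self,
        springerBetti_pair_zero (by omega)]
      omega
    | succ a hab iha =>
      rw [springerBetti_succ_add_two hab zero_le_one, iha, sub_self,
        springerBetti_pair_zero (by omega)]
      omega

theorem two_mul_springerBetti_pair_two {a b : ℕ} (hab : b + 2 ≤ a) :
    2 * springerBetti [a, b + 2] 2 + 3 * (a + (b + 2)) = (a + (b + 2)) ^ 2 := by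
  induction b generalizing a with
  | zero =>
    induction a, hab using Nat.le_induction with
    | base =>
      rw [springerBetti_add_two_self 0 zero_le_two, show (2 : ℤ) - 1 = 1 by norm_num,
        springerBetti_hook_two 1, springerBetti_hook_one 1]
      norm_num
    | succ a hab iha =>
      rw [springerBetti_succ_add_two hab zero_le_two, show (2 : ℤ) - 1 = 1 by norm_num,
        springerBetti_pair_one (by omega)]
      linarith
  | succ b ih =>
    induction a, hab using Nat.le_induction with
    | base =>
      have h := ih (a := b + 3) (by omega)
      rw [springerBetti_add_two_self (b + 1) zero_le_two, show (2 : ℤ) - 1 = 1 by norm_num,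
        springerBetti_pair_one (by omega)]
      linarith
    | succ a hab iha =>
      rw [springerBetti_succ_add_two hab zero_le_two, show (2 : ℤ) - 1 = 1 by norm_num,
        springerBetti_pair_one (by omega)]
      linarith

/-- For every partition `λ = (λ₁, λ₂)` of `n` with two positive parts and `λ₂ ≥ 2`,
`b(λ,2) = (n² − 3n)/2`. -/
theorem betti_two_two_rows (n a b : ℕ) (hab : b ≤ a) (hb : 2 ≤ b) (hsum : a + b = n) :
    (springerBetti [a, b] 2 : ℚ) = ((n : ℚ) ^ 2 - 3 * n) / 2 := by
  obtain ⟨c, rfl⟩ := Nat.exists_eq_add_of_le' hb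
  have h := two_mul_springerBetti_pair_two hab
  rw [hsum] at h
  have h' : (2 * springerBetti [a, c + 2] 2 + 3 * n : ℚ) = (n : ℚ) ^ 2 := by exact_mod_cast h
  linarith
end

section
/- For all integers n ≥ 1 and k ≥ 0, b((1^n), k) equals the number of permutations w of {1,…,n} with exactly k inversions, i.e. #{w ∈ S_n : #{(i,j) : i < j, w(i) > w(j)} = k}. (This is the 2k-th Betti number of the full flag variety of GL_n(ℂ).) -/
/-- The number of inversions of a permutation of `Fin n`. -/
def permInversions {n : ℕ} (w : Equiv.Perm (Fin n)) : ℕ :=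
  (Finset.univ.filter (fun p : Fin n × Fin n => p.1 < p.2 ∧ w p.2 < w p.1)).card

/-- The permutation of `Fin (n + 1)` sending `0` to `p` and ordered like `e` on the rest. -/
def permCons {n : ℕ} (p : Fin (n + 1)) (e : Equiv.Perm (Fin n)) : Equiv.Perm (Fin (n + 1)) :=
  (finSuccEquiv' 0).trans ((Equiv.optionCongr e).trans (finSuccEquiv' p).symm)

@[simp]
lemma permCons_zero {n : ℕ} (p : Fin (n + 1)) (e : Equiv.Perm (Fin n)) :
    permCons p e 0 = p := by
  simp [permCons]

@[simp]
lemma permCons_succ {n : ℕ} (p : Fin (n + 1)) (e : Equiv.Perm (Fin n)) (i : Fin n) :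
    permCons p e i.succ = p.succAbove (e i) := by
  have h : finSuccEquiv' (0 : Fin (n + 1)) i.succ = some i := by
    rw [← Fin.succAbove_zero, finSuccEquiv'_succAbove]
  simp [permCons, h]

lemma permCons_bijective (n : ℕ) :
    Function.Bijective
      (fun x : Fin (n + 1) × Equiv.Perm (Fin n) => permCons x.1 x.2) := by
  rw [Fintype.bijective_iff_injective_and_card]
  constructor
  · rintro ⟨p, e⟩ ⟨q, f⟩ h
    have h : permCons p e = permCons q f := h
    obtain rfl : p = q := by simpa using congrArg (fun w => w 0) h
    have hef : e = f := Equiv.ext fun i => by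
      simpa using congrArg (fun w => w i.succ) h
    rw [hef]
  · simp [Fintype.card_perm, Nat.factorial_succ]

lemma permInversions_eq_sum {n : ℕ} (w : Equiv.Perm (Fin n)) :
    permInversions w = ∑ i, ∑ j, if i < j ∧ w j < w i then 1 else 0 := by
  rw [permInversions, Finset.card_filter, Fintype.sum_prod_type]

lemma card_filter_succAbove_lt {n : ℕ} (p : Fin (n + 1)) :
    (Finset.univ.filter (fun j : Fin n => p.succAbove j < p)).card = p := by
  simp only [Fin.succAbove_lt_iff_castSucc_lt]
  simp only [Fin.lt_def, Fin.val_castSucc]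
  rw [Fin.card_filter_val_lt]
  exact min_eq_right p.is_le

lemma permInversions_permCons {n : ℕ} (p : Fin (n + 1)) (e : Equiv.Perm (Fin n)) :
    permInversions (permCons p e) = p + permInversions e := by
  simp only [permInversions_eq_sum, Fin.sum_univ_succ, permCons_zero, permCons_succ,
    Fin.succ_lt_succ_iff, (Fin.strictMono_succAbove p).lt_iff_lt, Fin.succ_pos, Fin.not_lt_zero,
    false_and, true_and, if_false, zero_add]
  rw [Equiv.sum_comp e (fun j => if p.succAbove j < p then 1 else 0), ← Finset.card_filter,
    card_filter_succAbove_lt]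

lemma card_permInversions_succ (n : ℕ) (k : ℤ) :
    (Finset.univ.filter
      (fun w : Equiv.Perm (Fin (n + 1)) => (permInversions w : ℤ) = k)).card =
      ∑ i ∈ Finset.range (n + 1), (Finset.univ.filter
        (fun w : Equiv.Perm (Fin n) => (permInversions w : ℤ) = k - i)).card := by
  simp only [Finset.card_filter]
  rw [← (permCons_bijective n).sum_comp, Fintype.sum_prod_type, Finset.sum_range]
  refine Finset.sum_congr rfl fun p _ => Finset.sum_congr rfl fun e _ => ?_
  simp only [permInversions_permCons, Nat.cast_add, eq_sub_iff_add_eq']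

lemma decPart_replicate_one {n i : ℕ} (hi : i < n + 1) :
    decPart (List.replicate (n + 1) 1) i = List.replicate n 1 := by
  have hset : ((List.replicate (n + 1) 1).set i 0).filter (fun x => x ≠ 0) =
      List.replicate n 1 := by
    rw [List.set_eq_take_append_cons_drop]
    simp [hi]
    omega
  have hget : (List.replicate (n + 1) 1).getD i 0 - 1 = 0 := by
    simp [List.getD_eq_getElem?_getD, hi]
  rw [decPart, hget, hset]
  exact List.Pairwise.insertionSort_eq (List.pairwise_replicate.2 (Or.inr le_rfl))

lemma bAux_replicate_one (n : ℕ) (k : ℤ) :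
    bAux n (List.replicate n 1) k = (Finset.univ.filter
      (fun w : Equiv.Perm (Fin n) => (permInversions w : ℤ) = k)).card := by
  induction n generalizing k with
  | zero =>
    by_cases hk : k = 0
    · simp [bAux, permInversions, hk]
    · simp [bAux, permInversions, hk, Ne.symm hk]
  | succ n ih =>
    rw [bAux]
    split_ifs with hk h
    · symm
      rw [Finset.card_eq_zero, Finset.filter_eq_empty_iff]
      intro w _
      omega
    · simp at h
    · simp at h
    · rw [card_permInversions_succ, List.length_replicate]
      refine Finset.sum_congr rfl fun i hi => ?_
      rw [decPart_replicate_one (Finset.mem_range.1 hi), ih]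

/-- `b((1^n), k)` is the number of permutations of `{1,…,n}` with exactly `k`
inversions, i.e. the `2k`-th Betti number of the full flag variety of `GL_n(ℂ)`. -/
theorem betti_replicate_eq_inversions (n k : ℕ) (hn : 1 ≤ n) :
    springerBetti (List.replicate n 1) k =
      (Finset.univ.filter (fun w : Equiv.Perm (Fin n) =>
        (Finset.univ.filter (fun p : Fin n × Fin n =>
          p.1 < p.2 ∧ w p.2 < w p.1)).card = k)).card := by
  have h := bAux_replicate_one n k
  simp only [Nat.cast_inj, permInversions] at h
  simpa [springerBetti] using h
end
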